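/- Let h ∈ (0,1) and T > 0, and let B = (B_t)_{t∈[0,T]} be an almost surely continuous process with B_0 = 0 such that for all 0 ≤ s < t ≤ T the increment B_t − B_s is Gaussian with mean 0 and variance |t−s|^{2h}/2. Then there exists a constant C_h > 0 depending only on h such that for all λ > 0, ℙ( sup_{t∈[0,T]} |B_t| ≥ 2λ ) ≤ (C_h T^h / λ) · exp( −λ²/(2 T^{2h}) ). -/

import Mathlib

open MeasureTheory Real ProbabilityTheory

lemma aux_tail {Ω : Type} [MeasurableSpace Ω] (μ : Measure Ω) [IsProbabilityMeasure μ]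
    (X : Ω → ℝ) (hX : Measurable X) (v : NNReal) (hmap : μ.map X = gaussianReal 0 v)
    (w : ℝ) (hw : 0 < w) (hv : (v : ℝ) ≤ w / 2) (a : ℝ) (ha : 0 ≤ a) :
    μ {ω | a ≤ |X ω|} ≤ ENNReal.ofReal (2 * exp (-a ^ 2 / w)) := by
  have hs : HasSubgaussianMGF X (w / 2).toNNReal μ := by
    constructor
    · intro t
      have := integrable_exp_mul_gaussianReal (μ := 0) (v := v) t
      rw [← hmap] at this
      exact this.comp_measurable hX
    · intro t
      rw [mgf_gaussianReal hmap t, Real.coe_toNNReal _ (by positivity)]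
      apply exp_le_exp.2
      have := mul_le_mul_of_nonneg_right hv (sq_nonneg t)
      linarith
  have h1 := hs.measure_ge_le ha
  have h2 := hs.neg.measure_ge_le ha
  have e : 2 * ((w / 2).toNNReal : ℝ) = w := by
    rw [Real.coe_toNNReal _ (by positivity)]; ring
  rw [e] at h1 h2
  have hsub : {ω | a ≤ |X ω|} ⊆ {ω | a ≤ X ω} ∪ {ω | a ≤ (-X) ω} := by
    intro ω hω
    have hω' : a ≤ |X ω| := hω
    exact le_abs.1 hω'
  have h3 : μ.real {ω | a ≤ |X ω|} ≤ 2 * exp (-a ^ 2 / w) :=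
    (measureReal_mono hsub).trans ((measureReal_union_le _ _).trans (by linarith))
  rw [← ENNReal.ofReal_toReal (measure_ne_top μ {ω | a ≤ |X ω|})]
  exact ENNReal.ofReal_le_ofReal h3

lemma aux_summable (M : ℕ) (hM : 1 ≤ M) :
    Summable (fun n : ℕ => ((M : ℝ) ^ (n + 1) + 1) * (2 * exp (-(9 / 16) * ((4 : ℝ) ^ n - 1)))) := by
  have hM' : (1 : ℝ) ≤ M := by exact_mod_cast hM
  set A : ℝ := (log M + 1) * (8 / 9) with hA
  refine Summable.of_nonneg_of_le (fun n => by positivity) (fun n => ?_)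
    (summable_exp_neg_nat.mul_left (4 * M * exp (9 / 16 * A ^ 2)))
  have h4 : (n : ℝ) ^ 2 ≤ 4 ^ n - 1 := by
    have : ∀ n : ℕ, n ^ 2 + 1 ≤ 4 ^ n := by
      intro n
      induction n with
      | zero => simp
      | succ k ih => rw [pow_succ 4]; nlinarith
    have := this n
    have : ((n : ℝ) ^ 2 + 1) ≤ 4 ^ n := by exact_mod_cast this
    linarith
  have hp : (M : ℝ) ^ n = exp (n * log M) := by
    rw [mul_comm, exp_mul, exp_log (by linarith), rpow_natCast]
  have h1 : (M : ℝ) ^ (n + 1) + 1 ≤ 2 * M * M ^ n := by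
    have : 1 ≤ (M : ℝ) ^ (n + 1) := one_le_pow₀ hM'
    rw [pow_succ] at *; linarith
  calc _ ≤ (2 * M * M ^ n) * (2 * exp (-(9 / 16) * ((4 : ℝ) ^ n - 1))) := by gcongr
    _ = 4 * M * exp (n * log M + -(9 / 16) * ((4 : ℝ) ^ n - 1)) := by
      rw [hp, exp_add]; ring
    _ ≤ 4 * M * exp (9 / 16 * A ^ 2 + -n) := by
      refine mul_le_mul_of_nonneg_left (exp_le_exp.2 ?_) (by positivity)
      have hl : log M = 9 / 8 * A - 1 := by rw [hA]; ring
      rw [hl]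
      nlinarith [sq_nonneg ((n : ℝ) - A)]
    _ = _ := by rw [exp_add]; ring

lemma aux_det (f : ℝ → ℝ) (T l : ℝ) (hT : 0 < T) (hl : 0 < l) (M : ℕ) (hM : 2 ≤ M)
    (hf : ContinuousOn f (Set.Icc 0 T)) (h0 : f 0 = 0) (h1 : |f T| < 3 / 4 * l)
    (hinc : ∀ n j : ℕ, j ≤ M ^ (n + 1) →
      |f (T * j / (M : ℝ) ^ (n + 1)) - f (T * (j / M : ℕ) / (M : ℝ) ^ n)| < 3 / 4 * l / 4 ^ n)
    (t : ℝ) (ht : t ∈ Set.Icc 0 T) : |f t| ≤ 7 / 4 * l := by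
  have hM' : (2 : ℝ) ≤ M := by exact_mod_cast hM
  have hMp : (0 : ℝ) < M := by linarith
  set u := t / T with hu
  have hu0 : 0 ≤ u := div_nonneg ht.1 hT.le
  have hu1 : u ≤ 1 := (div_le_one hT).2 ht.2
  have htu : t = T * u := by rw [hu]; field_simp
  let k : ℕ → ℕ := fun n => ⌊u * (M : ℝ) ^ n⌋₊
  let p : ℕ → ℝ := fun n => T * (k n) / (M : ℝ) ^ n
  have hk : ∀ n, k (n + 1) / M = k n := by
    intro n
    simp only [k]
    rw [← Nat.floor_div_natCast]
    congr 1
    rw [pow_succ]; field_simp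
  have hkle : ∀ n, k n ≤ M ^ n := by
    intro n
    apply Nat.floor_le_of_le
    push_cast
    have : (0 : ℝ) < (M : ℝ) ^ n := by positivity
    nlinarith
  have hp0 : |f (p 0)| ≤ 3 / 4 * l := by
    have := hkle 0
    have h2 : k 0 = 0 ∨ k 0 = 1 := by
      rw [pow_zero] at this; omega
    rcases h2 with h2 | h2
    · simp only [p, h2]; simp [h0, hl.le]
    · simp only [p, h2]; simp [h1.le]
  have hpn : ∀ n, |f (p n)| ≤ 3 / 4 * l + l * (1 - 1 / 4 ^ n) := by
    intro n
    induction n with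
    | zero => simpa using hp0
    | succ n ih =>
      have := hinc n (k (n + 1)) (hkle _)
      rw [hk n] at this
      change |f (p (n + 1)) - f (p n)| < _ at this
      have h3 := abs_add_le (f (p (n + 1)) - f (p n)) (f (p n))
      rw [sub_add_cancel] at h3
      have h4 : 3 / 4 * l + l * (1 - 1 / 4 ^ (n + 1)) =
        3 / 4 * l / 4 ^ n + (3 / 4 * l + l * (1 - 1 / 4 ^ n)) := by
        rw [pow_succ]; field_simp; ring
      linarith
  have hpm : ∀ n, p n ∈ Set.Icc 0 T := by
    intro n
    have hpos : (0 : ℝ) < (M : ℝ) ^ n := by positivity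
    refine ⟨by positivity, ?_⟩
    simp only [p]
    rw [div_le_iff₀ hpos]
    have : (k n : ℝ) ≤ (M : ℝ) ^ n := by exact_mod_cast hkle n
    gcongr
  have hlim : Filter.Tendsto p Filter.atTop (nhds t) := by
    have a1 := tendsto_nat_floor_mul_div_atTop (R := ℝ) hu0
    have a2 : Filter.Tendsto (fun n : ℕ => (M : ℝ) ^ n) Filter.atTop Filter.atTop :=
      tendsto_pow_atTop_atTop_of_one_lt (by linarith)
    have a3 := (a1.comp a2).const_mul T
    rw [← htu] at a3
    refine a3.congr (fun n => ?_)
    simp only [p, k, Function.comp]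
    ring
  have hlim' : Filter.Tendsto p Filter.atTop (nhdsWithin t (Set.Icc 0 T)) :=
    tendsto_nhdsWithin_iff.2 ⟨hlim, Filter.Eventually.of_forall hpm⟩
  have hlf := ((hf t ht).tendsto.comp hlim').abs
  refine le_of_tendsto hlf (Filter.Eventually.of_forall (fun n => ?_))
  refine (hpn n).trans ?_
  have : 0 ≤ l * (1 / 4 ^ n) := by positivity
  linarith

lemma aux_main {h : ℝ} (hh : 0 < h) (M : ℕ) (hM : 2 ≤ M) (hMh : (64 : ℝ) ≤ (M : ℝ) ^ (2 * h))
    (Ω : Type) (_ : MeasurableSpace Ω) (μ : Measure Ω) [IsProbabilityMeasure μ]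
    (T : ℝ) (hT : 0 < T) (B : ℝ → Ω → ℝ) (hB : ∀ t, Measurable (B t)) (h0 : ∀ ω, B 0 ω = 0)
    (hc : ∀ᵐ ω ∂μ, ContinuousOn (fun t => B t ω) (Set.Icc 0 T))
    (hg : ∀ s t : ℝ, 0 ≤ s → s < t → t ≤ T →
        μ.map (fun ω => B t ω - B s ω) =
          gaussianReal 0 ((|t - s| ^ (2 * h) / 2).toNNReal))
    (l : ℝ) (hl : 0 < l) (hx : 1 ≤ l ^ 2 / T ^ (2 * h)) :
    (μ {ω | 2 * l ≤ ⨆ t ∈ Set.Icc (0 : ℝ) T, |B t ω|}).toReal ≤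
      (2 + ∑' n : ℕ, ((M : ℝ) ^ (n + 1) + 1) * (2 * exp (-(9 / 16) * ((4 : ℝ) ^ n - 1)))) *
        exp (-(9 / 16) * (l ^ 2 / T ^ (2 * h))) := by
  have hM' : (2 : ℝ) ≤ M := by exact_mod_cast hM
  have hMp : (0 : ℝ) < M := by linarith
  set W := T ^ (2 * h) with hW
  have hWp : 0 < W := rpow_pos_of_pos hT _
  set x := l ^ 2 / W with hxdef
  have hinc : ∀ (n : ℕ) (s t : ℝ), 0 ≤ s → s ≤ t → t ≤ T → t - s ≤ T / (M : ℝ) ^ n →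
      μ {ω | 3 / 4 * l / 4 ^ n ≤ |B t ω - B s ω|} ≤
        ENNReal.ofReal (2 * exp (-(9 / 16) * (4 ^ n * x))) := by
    intro n s t hs hst ht hd
    rcases hst.eq_or_lt with rfl | hst
    · have : {ω | 3 / 4 * l / 4 ^ n ≤ |B s ω - B s ω|} = ∅ := by
        ext ω
        have : 0 < 3 / 4 * l / 4 ^ n := by positivity
        simpa using this
      rw [this]; simp
    have hw : 0 < W / 64 ^ n := by positivity
    have := aux_tail μ (fun ω => B t ω - B s ω) ((hB t).sub (hB s)) _ (hg s t hs hst ht)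
      (W / 64 ^ n) hw ?_ (3 / 4 * l / 4 ^ n) (by positivity)
    · refine this.trans (le_of_eq ?_)
      congr 3
      rw [hxdef]
      have : (64 : ℝ) ^ n = 4 ^ n * 4 ^ n * 4 ^ n := by
        rw [← mul_pow, ← mul_pow]; norm_num
      rw [this]; field_simp; ring
    · rw [Real.coe_toNNReal _ (by positivity)]
      have : |t - s| ^ (2 * h) ≤ W / 64 ^ n := by
        rw [abs_of_pos (by linarith)]
        calc (t - s) ^ (2 * h) ≤ (T / (M : ℝ) ^ n) ^ (2 * h) :=
              rpow_le_rpow (by linarith) hd (by linarith)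
          _ = W / ((M : ℝ) ^ (2 * h)) ^ n := by
              rw [div_rpow hT.le (by positivity), hW]
              congr 1
              rw [← rpow_natCast, ← rpow_natCast, ← rpow_mul hMp.le, ← rpow_mul hMp.le, mul_comm]
          _ ≤ W / 64 ^ n := by gcongr
      linarith
  let E : ℕ → ℕ → Set Ω := fun n j => {ω | 3 / 4 * l / 4 ^ n ≤
    |B (T * j / (M : ℝ) ^ (n + 1)) ω - B (T * (j / M : ℕ) / (M : ℝ) ^ n) ω|}
  have hE : ∀ n j, j ≤ M ^ (n + 1) → μ (E n j) ≤
      ENNReal.ofReal (2 * exp (-(9 / 16) * (4 ^ n * x))) := by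
    intro n j hj
    have hpos : (0 : ℝ) < (M : ℝ) ^ n := by positivity
    have hd : ((j / M : ℕ) : ℝ) * M ≤ j := by exact_mod_cast Nat.div_mul_le_self j M
    have hd2 : (j : ℝ) ≤ ((j / M : ℕ) : ℝ) * M + M := by
      have := Nat.lt_div_mul_add (a := j) (b := M) (by omega)
      exact_mod_cast this.le
    have e1 : T * ((j / M : ℕ) : ℝ) / (M : ℝ) ^ n = T * (((j / M : ℕ) : ℝ) * M) / (M : ℝ) ^ (n + 1) := by
      rw [pow_succ]; field_simp
    apply hinc
    · positivity
    · rw [e1]; gcongr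
    · rw [div_le_iff₀ (by positivity)]
      gcongr
      exact_mod_cast hj
    · rw [e1, ← sub_div, ← mul_sub]
      have e2 : T / (M : ℝ) ^ n = T * M / (M : ℝ) ^ (n + 1) := by
        rw [pow_succ]; field_simp
      rw [e2]
      gcongr
      linarith
  let E0 : Set Ω := {ω | 3 / 4 * l ≤ |B T ω|}
  have hE0 : μ E0 ≤ ENNReal.ofReal (2 * exp (-(9 / 16) * x)) := by
    have := hinc 0 0 T le_rfl hT.le le_rfl (by simp)
    simpa [h0] using this
  let F : ℕ → Set Ω := fun n => ⋃ j ∈ Finset.range (M ^ (n + 1) + 1), E n j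
  let N : Set Ω := {ω | ¬ ContinuousOn (fun t => B t ω) (Set.Icc 0 T)}
  have hN : μ N = 0 := hc
  let a : ℕ → ℝ := fun n => ((M : ℝ) ^ (n + 1) + 1) * (2 * exp (-(9 / 16) * ((4 : ℝ) ^ n - 1)))
  have ha0 : ∀ n, 0 ≤ a n := fun n => by positivity
  have has : Summable a := aux_summable M (by omega)
  have hF : ∀ n, μ (F n) ≤ ENNReal.ofReal (a n * exp (-(9 / 16) * x)) := by
    intro n
    refine (measure_biUnion_finset_le _ _).trans ?_
    refine (Finset.sum_le_sum (fun j hj => hE n j (by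
      have := Finset.mem_range.1 hj; omega))).trans ?_
    rw [Finset.sum_const, Finset.card_range, nsmul_eq_mul, ← ENNReal.ofReal_natCast,
      ← ENNReal.ofReal_mul (by positivity)]
    apply ENNReal.ofReal_le_ofReal
    simp only [a]
    rw [mul_assoc, mul_assoc, ← exp_add]
    push_cast
    gcongr
    have h4 : (1 : ℝ) ≤ 4 ^ n := one_le_pow₀ (by norm_num)
    nlinarith [mul_nonneg (sub_nonneg.2 h4) (sub_nonneg.2 hx)]
  have hsub : {ω | 2 * l ≤ ⨆ t ∈ Set.Icc (0 : ℝ) T, |B t ω|} ⊆ N ∪ (E0 ∪ ⋃ n, F n) := by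
    intro ω hω
    by_contra hcon
    simp only [Set.mem_union, not_or, Set.mem_iUnion, not_exists, F, Finset.mem_range] at hcon
    obtain ⟨c1, c2, c3⟩ := hcon
    have c1' : ContinuousOn (fun t => B t ω) (Set.Icc 0 T) := not_not.1 c1
    have key := aux_det (fun t => B t ω) T l hT hl M hM c1' (h0 ω) (not_le.1 c2)
      (fun n j hj => not_le.1 (c3 n j (by omega)))
    have : ⨆ t ∈ Set.Icc (0 : ℝ) T, |B t ω| ≤ 7 / 4 * l :=
      Real.iSup_le (fun t => Real.iSup_le (fun ht => key t ht) (by positivity)) (by positivity)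
    have hω' : 2 * l ≤ ⨆ t ∈ Set.Icc (0 : ℝ) T, |B t ω| := hω
    linarith
  have hsum : Summable (fun n => a n * exp (-(9 / 16) * x)) := has.mul_right _
  have htot : μ {ω | 2 * l ≤ ⨆ t ∈ Set.Icc (0 : ℝ) T, |B t ω|} ≤
      ENNReal.ofReal ((2 + ∑' n, a n) * exp (-(9 / 16) * x)) := by
    refine (measure_mono hsub).trans ((measure_union_le _ _).trans ?_)
    rw [hN, zero_add]
    refine (measure_union_le _ _).trans ?_
    rw [add_mul, ← tsum_mul_right, ENNReal.ofReal_add (by positivity)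
      (tsum_nonneg fun n => mul_nonneg (ha0 n) (exp_pos _).le),
      ENNReal.ofReal_tsum_of_nonneg (fun n => mul_nonneg (ha0 n) (exp_pos _).le) hsum]
    exact add_le_add hE0 ((measure_iUnion_le _).trans (ENNReal.tsum_le_tsum hF))
  exact ENNReal.toReal_le_of_le_ofReal
    (mul_nonneg (add_nonneg zero_le_two (tsum_nonneg ha0)) (exp_pos _).le) htot

theorem statement9 {h : ℝ} (hh : h ∈ Set.Ioo (0 : ℝ) 1) :
    ∃ C_h > (0 : ℝ), ∀ (Ω : Type) (_ : MeasurableSpace Ω) (μ : Measure Ω),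
      IsProbabilityMeasure μ → ∀ T : ℝ, 0 < T → ∀ B : ℝ → Ω → ℝ,
      (∀ t, Measurable (B t)) →
      (∀ ω, B 0 ω = 0) →
      (∀ᵐ ω ∂μ, ContinuousOn (fun t => B t ω) (Set.Icc 0 T)) →
      (∀ s t : ℝ, 0 ≤ s → s < t → t ≤ T →
        μ.map (fun ω => B t ω - B s ω) =
          gaussianReal 0 ((|t - s| ^ (2 * h) / 2).toNNReal)) →
      ∀ l : ℝ, 0 < l →
        (μ {ω | 2 * l ≤ ⨆ t ∈ Set.Icc (0 : ℝ) T, |B t ω|}).toReal ≤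
          C_h * T ^ h / l * Real.exp (-l ^ 2 / (2 * T ^ (2 * h))) := by
  have hh0 := hh.1
  obtain ⟨M, hM, hMh⟩ : ∃ M : ℕ, 2 ≤ M ∧ (64 : ℝ) ≤ (M : ℝ) ^ (2 * h) := by
    have t1 := (tendsto_rpow_atTop (y := 2 * h) (by linarith)).comp tendsto_natCast_atTop_atTop
    obtain ⟨M, h1, h2⟩ := ((Filter.eventually_ge_atTop 2).and
      (t1.eventually_ge_atTop 64)).exists
    exact ⟨M, h1, h2⟩
  set S : ℝ := 2 + ∑' n : ℕ, ((M : ℝ) ^ (n + 1) + 1) *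
    (2 * exp (-(9 / 16) * ((4 : ℝ) ^ n - 1))) with hS
  have hS2 : 2 ≤ S := by
    have : 0 ≤ ∑' n : ℕ, ((M : ℝ) ^ (n + 1) + 1) *
      (2 * exp (-(9 / 16) * ((4 : ℝ) ^ n - 1))) := tsum_nonneg fun n => by positivity
    linarith
  refine ⟨2 * S, by linarith, ?_⟩
  intro Ω _ μ hμ T hT B hB h0 hc hg l hl
  have hTh : 0 < T ^ h := rpow_pos_of_pos hT _
  set x := l / T ^ h with hx
  have hxp : 0 < x := by positivity
  have hW : T ^ (2 * h) = (T ^ h) ^ 2 := by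
    rw [mul_comm, rpow_mul hT.le, rpow_two]
  have e1 : l ^ 2 / T ^ (2 * h) = x ^ 2 := by rw [hW, hx, div_pow]
  have e2 : -l ^ 2 / (2 * T ^ (2 * h)) = -(x ^ 2 / 2) := by rw [← e1]; field_simp
  have e3 : 2 * S * T ^ h / l = 2 * S / x := by rw [hx]; field_simp
  rw [e2, e3]
  rcases le_total 1 x with h1 | h1
  · have := aux_main hh0 M hM hMh Ω _ μ T hT B hB h0 hc hg l hl (by rw [e1]; nlinarith)
    rw [e1] at this
    refine this.trans ?_
    rw [← hS, div_mul_eq_mul_div, le_div_iff₀ hxp]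
    have k1 : x ≤ 2 * exp (x ^ 2 / 16) := by
      have := add_one_le_exp (x ^ 2 / 16)
      nlinarith [sq_nonneg (x - 4)]
    calc S * exp (-(9 / 16) * x ^ 2) * x
        ≤ S * exp (-(9 / 16) * x ^ 2) * (2 * exp (x ^ 2 / 16)) := by gcongr
      _ = 2 * S * (exp (-(9 / 16) * x ^ 2) * exp (x ^ 2 / 16)) := by ring
      _ = 2 * S * exp (-(x ^ 2 / 2)) := by rw [← exp_add]; congr 2; ring
  · have p1 : (μ {ω | 2 * l ≤ ⨆ t ∈ Set.Icc (0 : ℝ) T, |B t ω|}).toReal ≤ 1 :=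
      measureReal_le_one
    refine p1.trans ?_
    rw [div_mul_eq_mul_div, le_div_iff₀ hxp]
    have := add_one_le_exp (-(x ^ 2 / 2))
    have k2 : 1 / 2 ≤ exp (-(x ^ 2 / 2)) := by nlinarith
    have k3 : 2 * (1 / 2) ≤ S * exp (-(x ^ 2 / 2)) := by gcongr
    linarith
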